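/- Consider a commutative diagram of Noetherian commutative rings with rows B₁ → B₀ ← B₂ and C₁ → C₀ ← C₂ and vertical maps Bᵢ → Cᵢ, where the maps b: B₂ → B₀ and c: C₂ → C₀ are surjective with nilpotent kernel, both squares are co-cartesian (Cᵢ ≅ C₀ ⊗ ... compatibly; i.e., the diagrams of rings are pushouts), and all vertical maps Bᵢ → Cᵢ are flat and unramified. Then the induced map B₁ ×_{B₀} B₂ → C₁ ×_{C₀} C₂ on fiber products is flat and unramified. -/

import Mathlib

section AuxiliaryLemmas

open TensorProduct LinearMap Function

section TorVanishing

variable {A K F D L G N : Type*} [CommRing A]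
  [AddCommGroup K] [AddCommGroup F] [AddCommGroup D] [AddCommGroup L] [AddCommGroup G]
  [AddCommGroup N] [Module A K] [Module A F] [Module A D] [Module A L] [Module A G] [Module A N]
  {i : K →ₗ[A] F} {π : F →ₗ[A] D} {f : L →ₗ[A] G} {g : G →ₗ[A] N}

/-- Let `0 → K → F → D → 0` be exact. If `K ⊗ G → F ⊗ G` and `D ⊗ L → D ⊗ G` are injective, then
so is `K ⊗ N → F ⊗ N`, where `N` is the cokernel of `L → G`. -/
lemma LinearMap.rTensor_injective_of_lTensor_injective (hπ : Surjective π) (hiπ : Exact i π)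
    (hg : Surjective g) (hfg : Exact f g) (hG : Injective (i.rTensor G))
    (hD : Injective (f.lTensor D)) : Injective (i.rTensor N) := by
  rw [injective_iff_map_eq_zero]
  intro x hx
  obtain ⟨y, rfl⟩ := LinearMap.lTensor_surjective K hg x
  have h1 : g.lTensor F (i.rTensor G y) = 0 := by
    rw [← hx, ← LinearMap.comp_apply, ← LinearMap.comp_apply, lTensor_comp_rTensor,
      rTensor_comp_lTensor]
  obtain ⟨z, hz⟩ := (lTensor_exact F hfg hg _).mp h1
  have h2 : π.rTensor L z = 0 := by
    refine (injective_iff_map_eq_zero _).mp hD _ ?_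
    rw [← LinearMap.comp_apply, lTensor_comp_rTensor, ← rTensor_comp_lTensor,
      LinearMap.comp_apply, hz]
    exact (rTensor_exact G hiπ hπ).apply_apply_eq_zero y
  obtain ⟨w, rfl⟩ := (rTensor_exact L hiπ hπ _).mp h2
  have h3 : f.lTensor K w = y := by
    apply hG
    rw [← hz, ← LinearMap.comp_apply, ← LinearMap.comp_apply, lTensor_comp_rTensor,
      rTensor_comp_lTensor]
  rw [← h3]
  exact (lTensor_exact K hfg hg).apply_apply_eq_zero w

/-- Let `0 → K → F → D → 0` and `0 → L → G → N → 0` be exact, with `F` flat. If `K ⊗ N → F ⊗ N` is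
injective, then so is `D ⊗ L → D ⊗ G`. -/
lemma LinearMap.lTensor_injective_of_rTensor_injective [Module.Flat A F] (hπ : Surjective π)
    (hiπ : Exact i π) (hf : Injective f) (hg : Surjective g) (hfg : Exact f g)
    (hN : Injective (i.rTensor N)) : Injective (f.lTensor D) := by
  rw [injective_iff_map_eq_zero]
  intro x hx
  obtain ⟨y, rfl⟩ := LinearMap.rTensor_surjective L hπ x
  have h1 : π.rTensor G (f.lTensor F y) = 0 := by
    rw [← hx, ← LinearMap.comp_apply, ← LinearMap.comp_apply, lTensor_comp_rTensor,
      rTensor_comp_lTensor]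
  obtain ⟨z, hz⟩ := (rTensor_exact G hiπ hπ _).mp h1
  have h2 : g.lTensor K z = 0 := by
    refine (injective_iff_map_eq_zero _).mp hN _ ?_
    rw [← LinearMap.comp_apply, rTensor_comp_lTensor, ← lTensor_comp_rTensor,
      LinearMap.comp_apply, hz]
    exact (lTensor_exact F hfg hg).apply_apply_eq_zero y
  obtain ⟨w, rfl⟩ := (lTensor_exact K hfg hg _).mp h2
  have h3 : i.rTensor L w = y := by
    apply Module.Flat.lTensor_preserves_injective_linearMap (M := F) f hf
    rw [← hz, ← LinearMap.comp_apply, ← LinearMap.comp_apply, lTensor_comp_rTensor,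
      rTensor_comp_lTensor]
  rw [← h3]
  exact (rTensor_exact L hiπ hπ).apply_apply_eq_zero w

lemma LinearMap.rTensor_injective_of_exact [Module.Flat A F] (hf : Injective f)
    (hg : Surjective g) (hfg : Exact f g) (hL : Injective (i.rTensor L))
    (hN : Injective (i.rTensor N)) : Injective (i.rTensor G) := by
  rw [injective_iff_map_eq_zero]
  intro x hx
  have h1 : g.lTensor K x = 0 := by
    refine (injective_iff_map_eq_zero _).mp hN _ ?_
    rw [← LinearMap.comp_apply, rTensor_comp_lTensor, ← lTensor_comp_rTensor,
      LinearMap.comp_apply, hx, map_zero]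
  obtain ⟨y, rfl⟩ := (lTensor_exact K hfg hg _).mp h1
  have h2 : i.rTensor L y = 0 := by
    refine (injective_iff_map_eq_zero _).mp
      (Module.Flat.lTensor_preserves_injective_linearMap (M := F) f hf) _ ?_
    rw [← hx, ← LinearMap.comp_apply, ← LinearMap.comp_apply, lTensor_comp_rTensor,
      rTensor_comp_lTensor]
  rw [(injective_iff_map_eq_zero _).mp hL _ h2, map_zero]

lemma LinearMap.rTensor_finsupp_injective (ι : Type*) (hG : Injective (i.rTensor G)) :
    Injective (i.rTensor (ι →₀ G)) := by
  classical
  have h : (finsuppRight A A F G ι).toLinearMap ∘ₗ i.rTensor (ι →₀ G) =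
      Finsupp.mapRange.linearMap (i.rTensor G) ∘ₗ (finsuppRight A A K G ι).toLinearMap := by
    ext k j x : 4
    simp [finsuppRight_apply_tmul]
  have h' : Injective ((finsuppRight A A F G ι).toLinearMap ∘ₗ i.rTensor (ι →₀ G)) := by
    rw [h]
    exact (Finsupp.mapRange_injective _ (map_zero _) hG).comp (finsuppRight A A K G ι).injective
  rw [LinearMap.coe_comp] at h'
  exact h'.of_comp

end TorVanishing

section LocalCriterion

universe u v w x

variable {A : Type u} (B : Type w) {D : Type v} {K F : Type*} [CommRing A] [CommRing B] [Algebra A B]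
  [AddCommGroup D] [Module A D] [AddCommGroup K] [Module A K] [AddCommGroup F] [Module A F]

lemma LinearMap.lTensor_restrictScalars_injective_of_flat [Module.Flat B (B ⊗[A] D)]
    {L G : Type*} [AddCommGroup L] [AddCommGroup G] [Module A L] [Module A G] [Module B L]
    [Module B G] [IsScalarTower A B L] [IsScalarTower A B G] (f : L →ₗ[B] G) (hf : Injective f) :
    Injective ((f.restrictScalars A).lTensor D) := by
  have h : (f.restrictScalars A).rTensor D ∘ₗ
      ((AlgebraTensorModule.cancelBaseChange A B B L D).restrictScalars A).toLinearMap =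
      ((AlgebraTensorModule.cancelBaseChange A B B G D).restrictScalars A).toLinearMap ∘ₗ
        (f.rTensor (B ⊗[A] D)).restrictScalars A := by
    ext x
    induction x with
    | zero => simp
    | add x y hx hy => rw [map_add, hx, hy, map_add]
    | tmul l y =>
      induction y with
      | zero => simp
      | add x y hx hy => rw [tmul_add, map_add, hx, hy, map_add]
      | tmul b d => simp
  have h' := (AlgebraTensorModule.cancelBaseChange A B B G D).injective.comp
    (Module.Flat.rTensor_preserves_injective_linearMap (M := B ⊗[A] D) f hf)
  rw [LinearMap.lTensor_inj_iff_rTensor_inj]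
  refine Injective.of_comp_right (g := AlgebraTensorModule.cancelBaseChange A B B L D) ?_
    (AlgebraTensorModule.cancelBaseChange A B B L D).surjective
  convert h'
  exact congr_arg DFunLike.coe h

lemma LinearMap.rTensor_injective_of_isScalarTower [Module.Flat B (B ⊗[A] D)]
    {i : K →ₗ[A] F} {π : F →ₗ[A] D} (hπ : Surjective π) (hiπ : Exact i π)
    (hB : Injective (i.rTensor B)) (N : Type x) [AddCommGroup N] [Module A N] [Module B N]
    [IsScalarTower A B N] : Injective (i.rTensor N) := by
  obtain ⟨G, _, _, _, _, hG, g, hg⟩ : ∃ (G : Type (max w x)) (_ : AddCommGroup G) (_ : Module A G)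
      (_ : Module B G) (_ : IsScalarTower A B G) (_ : Injective (i.rTensor G)) (g : G →ₗ[B] N),
      Surjective g :=
    ⟨N →₀ B, inferInstance, inferInstance, inferInstance, inferInstance,
      rTensor_finsupp_injective N hB, _, Finsupp.linearCombination_id_surjective B N⟩
  have hD := lTensor_restrictScalars_injective_of_flat (A := A) (D := D) B
    (LinearMap.ker g).subtype (Submodule.subtype_injective _)
  exact rTensor_injective_of_lTensor_injective (g := g.restrictScalars A) hπ hiπ hg
    (LinearMap.exact_subtype_ker_map g) hG hD

variable {B}

lemma LinearMap.rTensor_injective_of_pow_smul_top_eq_bot [Module.Flat B (B ⊗[A] D)]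
    [Module.Flat A F] {i : K →ₗ[A] F} {π : F →ₗ[A] D} (hπ : Surjective π) (hiπ : Exact i π)
    (hs : Surjective (algebraMap A B)) (hB : Injective (i.rTensor B)) (n : ℕ) :
    ∀ (N : Type*) [AddCommGroup N] [Module A N],
      RingHom.ker (algebraMap A B) ^ n • (⊤ : Submodule A N) = ⊥ → Injective (i.rTensor N) := by
  induction n with
  | zero =>
    intro N _ _ h
    have : Subsingleton N := by
      rw [pow_zero, Ideal.one_eq_top, Submodule.top_smul] at h
      exact (Submodule.subsingleton_iff A).mp (subsingleton_of_bot_eq_top h.symm)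
    exact injective_of_subsingleton _
  | succ n ih =>
    intro N _ _ h
    let N' : Submodule A N := RingHom.ker (algebraMap A B) • ⊤
    refine rTensor_injective_of_exact (f := N'.subtype) (g := N'.mkQ)
      N'.subtype_injective N'.mkQ_surjective (LinearMap.exact_subtype_mkQ N') (ih _ ?_) ?_
    · apply Submodule.map_injective_of_injective N'.subtype_injective
      rw [Submodule.map_smul'', Submodule.map_top, Submodule.range_subtype, Submodule.map_bot,
        ← h, pow_succ, Submodule.mul_smul]
    · let : Module B (N ⧸ N') := Module.compHom _
        (RingHom.quotientKerEquivOfSurjective hs).symm.toRingHom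
      have : IsScalarTower A B (N ⧸ N') := by
        refine IsScalarTower.of_algebraMap_smul fun a x ↦ ?_
        change (RingHom.quotientKerEquivOfSurjective hs).symm (algebraMap A B a) • x = a • x
        rw [show (RingHom.quotientKerEquivOfSurjective hs).symm (algebraMap A B a) =
          Ideal.Quotient.mk _ a from (RingEquiv.symm_apply_eq _).mpr rfl]
        exact algebraMap_smul (A ⧸ RingHom.ker (algebraMap A B)) a x
      exact rTensor_injective_of_isScalarTower B hπ hiπ hB _

lemma Module.flat_of_exact_of_isNilpotent_ker [Module.Flat B (B ⊗[A] D)]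
    [Module.Flat A F] {i : K →ₗ[A] F} {π : F →ₗ[A] D} (hi : Function.Injective i)
    (hπ : Surjective π) (hiπ : Exact i π) (hs : Surjective (algebraMap A B))
    (hnil : IsNilpotent (RingHom.ker (algebraMap A B)))
    (hI : Function.Injective ((RingHom.ker (algebraMap A B)).subtype.lTensor D)) :
    Module.Flat A D := by
  obtain ⟨n, hn⟩ := hnil
  have hA : Function.Injective (i.rTensor A) :=
    Module.Flat.rTensor_preserves_injective_linearMap _ hi
  have hB : Function.Injective (i.rTensor B) :=
    rTensor_injective_of_lTensor_injective
      (f := (RingHom.ker (algebraMap A B)).subtype) (g := Algebra.linearMap A B)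
      hπ hiπ hs (fun x ↦ by simp [RingHom.mem_ker]) hA hI
  rw [Module.Flat.iff_lTensor_injective']
  intro J
  refine lTensor_injective_of_rTensor_injective (f := J.subtype) (g := J.mkQ) hπ hiπ
    J.subtype_injective J.mkQ_surjective (LinearMap.exact_subtype_mkQ J)
    (rTensor_injective_of_pow_smul_top_eq_bot hπ hiπ hs hB n _ ?_)
  rw [hn, Ideal.zero_eq_bot, Submodule.bot_smul]

/-- The local criterion of flatness for a nilpotent ideal. -/
theorem Module.flat_of_isNilpotent_ker [Module.Flat B (B ⊗[A] D)]
    (hs : Surjective (algebraMap A B)) (hnil : IsNilpotent (RingHom.ker (algebraMap A B)))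
    (hI : Function.Injective ((RingHom.ker (algebraMap A B)).subtype.lTensor D)) :
    Module.Flat A D := by
  obtain ⟨F, _, _, _, π, hπ⟩ : ∃ (F : Type (max u v)) (_ : AddCommGroup F) (_ : Module A F)
      (_ : Module.Flat A F) (π : F →ₗ[A] D), Surjective π :=
    ⟨D →₀ A, inferInstance, inferInstance, inferInstance, _,
      Finsupp.linearCombination_id_surjective A D⟩
  exact flat_of_exact_of_isNilpotent_ker (Submodule.subtype_injective (LinearMap.ker π)) hπ
    (LinearMap.exact_subtype_ker_map π) hs hnil hI

end LocalCriterion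

section NilpotentKernel

variable {R S M N : Type*} [CommRing R] [CommRing S] [Algebra R S] [AddCommGroup M] [Module R M]
  [AddCommGroup N] [Module R N]

lemma Submodule.eq_top_of_sup_smul_top_eq_top {I : Ideal R} (hI : IsNilpotent I)
    {P : Submodule R M} (h : P ⊔ I • ⊤ = ⊤) : P = ⊤ := by
  obtain ⟨n, hn⟩ := hI
  have key (n : ℕ) : P ⊔ I ^ n • ⊤ = ⊤ := by
    induction n with
    | zero => simp [Ideal.one_eq_top]
    | succ n ih =>
      have h' : I ^ n • (⊤ : Submodule R M) ≤ P ⊔ I ^ (n + 1) • ⊤ := calc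
        I ^ n • (⊤ : Submodule R M) = I ^ n • (P ⊔ I • ⊤) := by rw [h]
        _ = I ^ n • P ⊔ I ^ (n + 1) • ⊤ := by
          rw [Submodule.smul_sup, ← Submodule.mul_smul, ← pow_succ]
        _ ≤ P ⊔ I ^ (n + 1) • ⊤ := sup_le_sup_right Submodule.smul_le_right _
      exact eq_top_iff.mpr (ih.ge.trans (sup_le le_sup_left h'))
  rw [← key n, hn, Ideal.zero_eq_bot, Submodule.bot_smul, sup_bot_eq]

/-- The kernel of `M → S ⊗ M` for a surjective ring homomorphism `R → S`. -/
lemma TensorProduct.mem_ker_smul_top_of_one_tmul_eq_zero (hs : Surjective (algebraMap R S)) {m : M}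
    (hm : (1 : S) ⊗ₜ[R] m = 0) : m ∈ RingHom.ker (algebraMap R S) • (⊤ : Submodule R M) := by
  let e : S ≃ₐ[R] R ⧸ RingHom.ker (algebraMap R S) :=
    (Ideal.quotientKerAlgEquivOfSurjective (f := Algebra.ofId R S) hs).symm
  rw [← LinearMap.ker_tensorProductMk, LinearMap.mem_ker]
  simpa using congr_arg (e.toLinearMap.rTensor M) hm

lemma TensorProduct.exists_one_tmul_eq (hs : Surjective (algebraMap R S)) (x : S ⊗[R] M) :
    ∃ m : M, (1 : S) ⊗ₜ[R] m = x := by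
  induction x with
  | zero => exact ⟨0, tmul_zero _ _⟩
  | tmul s m =>
    obtain ⟨r, rfl⟩ := hs s
    exact ⟨r • m, by rw [tmul_smul, smul_tmul', ← Algebra.algebraMap_eq_smul_one]⟩
  | add x y hx hy =>
    obtain ⟨m, rfl⟩ := hx
    obtain ⟨n, rfl⟩ := hy
    exact ⟨m + n, tmul_add _ _ _⟩

lemma IsBaseChange.of_ker_le_smul_top [Module S N] [IsScalarTower R S N]
    (hs : Surjective (algebraMap R S)) {f : M →ₗ[R] N} (hf : Surjective f)
    (hker : LinearMap.ker f ≤ RingHom.ker (algebraMap R S) • ⊤) : IsBaseChange S f := by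
  have hbij : Bijective (f.liftBaseChange S) := by
    refine ⟨(injective_iff_map_eq_zero _).mpr fun x hx ↦ ?_, fun n ↦ ?_⟩
    · obtain ⟨m, rfl⟩ := TensorProduct.exists_one_tmul_eq hs x
      rw [LinearMap.liftBaseChange_tmul, one_smul] at hx
      refine Submodule.smul_induction_on (hker hx) (fun r hr m _ ↦ ?_) fun x y hx hy ↦ ?_
      · rw [tmul_smul, smul_tmul', Algebra.smul_def, RingHom.mem_ker.mp hr, zero_mul, zero_tmul]
      · rw [tmul_add, hx, hy, add_zero]
    · obtain ⟨m, rfl⟩ := hf n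
      exact ⟨1 ⊗ₜ m, by simp⟩
  exact IsBaseChange.of_equiv (LinearEquiv.ofBijective _ hbij) fun x ↦ by simp

lemma IsBaseChange.mem_ker_smul_top [Module S N] [IsScalarTower R S N]
    (hs : Surjective (algebraMap R S)) {f : M →ₗ[R] N} (hf : IsBaseChange S f) {m : M}
    (hm : f m = 0) : m ∈ RingHom.ker (algebraMap R S) • (⊤ : Submodule R M) := by
  apply TensorProduct.mem_ker_smul_top_of_one_tmul_eq_zero hs
  apply hf.equiv.injective
  rw [hf.equiv_tmul, hm, smul_zero, map_zero]

lemma subsingleton_of_subsingleton_tensorProduct (hs : Surjective (algebraMap R S))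
    (hnil : IsNilpotent (RingHom.ker (algebraMap R S))) [Subsingleton (S ⊗[R] M)] :
    Subsingleton M := by
  have h : (⊥ : Submodule R M) = ⊤ := by
    refine Submodule.eq_top_of_sup_smul_top_eq_top hnil ?_
    rw [bot_sup_eq, eq_top_iff]
    exact fun m _ ↦ TensorProduct.mem_ker_smul_top_of_one_tmul_eq_zero hs (Subsingleton.elim _ _)
  exact (Submodule.subsingleton_iff R).mp (subsingleton_of_bot_eq_top h)

/-- A surjection onto a flat module is injective if it is so modulo a nilpotent ideal. -/
lemma LinearMap.injective_of_lTensor_injective (hs : Surjective (algebraMap R S))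
    (hnil : IsNilpotent (RingHom.ker (algebraMap R S))) [Module.Flat R N] {f : M →ₗ[R] N}
    (hf : Surjective f) (hfS : Injective (f.lTensor S)) : Injective f := by
  have hinj := LinearMap.lTensor_injective_of_exact_of_flat f hf (LinearMap.ker f).subtype
    (Submodule.subtype_injective _) (LinearMap.exact_subtype_ker_map f) S
  have : Subsingleton (S ⊗[R] LinearMap.ker f) := by
    refine subsingleton_of_forall_eq 0 fun x ↦ hinj (hfS ?_)
    rw [← LinearMap.comp_apply, ← LinearMap.lTensor_comp]
    simp [LinearMap.comp_ker_subtype]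
  have := subsingleton_of_subsingleton_tensorProduct (M := LinearMap.ker f) hs hnil
  rw [← LinearMap.ker_eq_bot]
  exact Submodule.eq_bot_of_subsingleton

end NilpotentKernel

section FiberProduct

/-- The commutative square `R → R₁`, `R → R₂`, `R₁ → R₀`, `R₂ → R₀` identifies `R` with the fiber
product `R₁ ×_{R₀} R₂`. -/
structure IsFiberProduct (R R₀ R₁ R₂ : Type*) [CommRing R] [CommRing R₀] [CommRing R₁] [CommRing R₂]
    [Algebra R R₁] [Algebra R R₂] [Algebra R₁ R₀] [Algebra R₂ R₀] : Prop where
  comm (r : R) : algebraMap R₁ R₀ (algebraMap R R₁ r) = algebraMap R₂ R₀ (algebraMap R R₂ r)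
  ext (r s : R) : algebraMap R R₁ r = algebraMap R R₁ s → algebraMap R R₂ r = algebraMap R R₂ s →
    r = s
  exists_lift (r₁ : R₁) (r₂ : R₂) : algebraMap R₁ R₀ r₁ = algebraMap R₂ R₀ r₂ →
    ∃ r : R, algebraMap R R₁ r = r₁ ∧ algebraMap R R₂ r = r₂

namespace IsFiberProduct

section

variable {A B₀ B₁ B₂ : Type*} [CommRing A] [CommRing B₀] [CommRing B₁] [CommRing B₂]
  [Algebra A B₁] [Algebra A B₂] [Algebra B₁ B₀] [Algebra B₂ B₀]

lemma surjective (hA : IsFiberProduct A B₀ B₁ B₂) (hb : Surjective (algebraMap B₂ B₀)) :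
    Surjective (algebraMap A B₁) := by
  intro b₁
  obtain ⟨b₂, hb₂⟩ := hb (algebraMap B₁ B₀ b₁)
  obtain ⟨a, ha, -⟩ := hA.exists_lift b₁ b₂ hb₂.symm
  exact ⟨a, ha⟩

lemma mem_ker (hA : IsFiberProduct A B₀ B₁ B₂) {a : A} (ha : a ∈ RingHom.ker (algebraMap A B₁)) :
    algebraMap A B₂ a ∈ RingHom.ker (algebraMap B₂ B₀) := by
  rw [RingHom.mem_ker] at ha ⊢
  rw [← hA.comm, ha, map_zero]

lemma exists_mem_ker (hA : IsFiberProduct A B₀ B₁ B₂) {b : B₂}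
    (hb : b ∈ RingHom.ker (algebraMap B₂ B₀)) :
    ∃ a ∈ RingHom.ker (algebraMap A B₁), algebraMap A B₂ a = b := by
  obtain ⟨a, ha, hab⟩ := hA.exists_lift 0 b (by rw [map_zero, RingHom.mem_ker.mp hb])
  exact ⟨a, ha, hab⟩

lemma isNilpotent_ker (hA : IsFiberProduct A B₀ B₁ B₂)
    (hnil : IsNilpotent (RingHom.ker (algebraMap B₂ B₀))) :
    IsNilpotent (RingHom.ker (algebraMap A B₁)) := by
  obtain ⟨n, hn⟩ := hnil
  refine ⟨n + 1, (Submodule.eq_bot_iff _).mpr fun a ha ↦ hA.ext a 0 ?_ ?_⟩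
  · rw [map_zero]
    exact Ideal.pow_le_self n.succ_ne_zero ha
  · have h : Ideal.map (algebraMap A B₂) (RingHom.ker (algebraMap A B₁)) ≤
        RingHom.ker (algebraMap B₂ B₀) := Ideal.map_le_iff_le_comap.mpr fun a ha ↦ hA.mem_ker ha
    have h' := Ideal.pow_right_mono h (n + 1)
    rw [← Ideal.map_pow, pow_succ (RingHom.ker (algebraMap B₂ B₀)), hn, zero_mul] at h'
    rw [map_zero]
    exact h' (Ideal.mem_map_of_mem _ ha)

end

variable {A B₀ B₁ B₂ D C₀ C₁ C₂ : Type*} [CommRing A] [CommRing B₀] [CommRing B₁] [CommRing B₂]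
  [CommRing D] [CommRing C₀] [CommRing C₁] [CommRing C₂]
  [Algebra A B₁] [Algebra A B₂] [Algebra B₁ B₀] [Algebra B₂ B₀]
  [Algebra D C₁] [Algebra D C₂] [Algebra C₁ C₀] [Algebra C₂ C₀]
  [Algebra A D] [Algebra B₀ C₀] [Algebra B₁ C₁] [Algebra B₂ C₂]
  [Algebra A C₁] [Algebra A C₂] [Algebra B₂ C₀]

/-- The span over `B₂` of the image of `D` is all of `C₂`. -/
lemma span_range_eq_top [Algebra B₁ C₀] [IsScalarTower B₂ B₀ C₀] [IsScalarTower B₂ C₂ C₀] [IsScalarTower B₁ B₀ C₀]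
    [IsScalarTower B₁ C₁ C₀] [Algebra.IsPushout B₁ B₀ C₁ C₀] [Algebra.IsPushout B₂ B₀ C₂ C₀]
    (hD : IsFiberProduct D C₀ C₁ C₂) (hb : Surjective (algebraMap B₂ B₀))
    (hbnil : IsNilpotent (RingHom.ker (algebraMap B₂ B₀))) (hc : Surjective (algebraMap C₂ C₀)) :
    Submodule.span B₂ (Set.range (algebraMap D C₂)) = ⊤ := by
  set P := Submodule.span B₂ (Set.range (algebraMap D C₂))
  have key (c₀ : C₀) : ∃ p ∈ P, algebraMap C₂ C₀ p = c₀ := by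
    have hpo : IsBaseChange B₀ (IsScalarTower.toAlgHom B₁ C₁ C₀).toLinearMap :=
      Algebra.IsPushout.out
    refine hpo.inductionOn c₀ (fun c₀ ↦ ∃ p ∈ P, algebraMap C₂ C₀ p = c₀) ?_ (fun c₁ ↦ ?_)
      (fun s c₀ h ↦ ?_) (fun x y hx hy ↦ ?_)
    · exact ⟨0, P.zero_mem, map_zero _⟩
    · obtain ⟨d, rfl⟩ := hD.surjective hc c₁
      exact ⟨_, Submodule.subset_span ⟨d, rfl⟩, (hD.comm d).symm⟩
    · obtain ⟨b, rfl⟩ := hb s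
      obtain ⟨p, hp, rfl⟩ := h
      refine ⟨b • p, P.smul_mem b hp, ?_⟩
      rw [Algebra.smul_def, Algebra.smul_def, map_mul, ← IsScalarTower.algebraMap_apply,
        ← IsScalarTower.algebraMap_apply]
    · obtain ⟨p, hp, rfl⟩ := hx
      obtain ⟨q, hq, rfl⟩ := hy
      exact ⟨p + q, P.add_mem hp hq, map_add _ _ _⟩
  refine Submodule.eq_top_of_sup_smul_top_eq_top hbnil (eq_top_iff.mpr fun c _ ↦ ?_)
  obtain ⟨p, hp, hpc⟩ := key (algebraMap C₂ C₀ c)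
  rw [← add_sub_cancel p c]
  refine Submodule.add_mem_sup hp ?_
  refine (Algebra.IsPushout.out (R := B₂) (S := B₀) (R' := C₂) (S' := C₀)).mem_ker_smul_top hb ?_
  simp [hpc]

/-- `C₁` is the base change of `D` along `A → B₁`. -/
lemma isBaseChange_left [IsScalarTower A B₁ C₁] [IsScalarTower A D C₁] [IsScalarTower A B₂ C₂]
    [IsScalarTower A D C₂] [IsScalarTower B₂ B₀ C₀] [IsScalarTower B₂ C₂ C₀]
    [Algebra.IsPushout B₂ B₀ C₂ C₀]
    (hA : IsFiberProduct A B₀ B₁ B₂) (hD : IsFiberProduct D C₀ C₁ C₂)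
    (hb : Surjective (algebraMap B₂ B₀)) (hc : Surjective (algebraMap C₂ C₀))
    (hspan : Submodule.span B₂ (Set.range (algebraMap D C₂)) = ⊤) :
    IsBaseChange B₁ (IsScalarTower.toAlgHom A D C₁).toLinearMap := by
  refine IsBaseChange.of_ker_le_smul_top (hA.surjective hb) (hD.surjective hc) fun d hd ↦ ?_
  replace hd : algebraMap D C₁ d = 0 := hd
  set I := RingHom.ker (algebraMap A B₁)
  have hI (e : D) (he : e ∈ I • (⊤ : Submodule A D)) : algebraMap D C₁ e = 0 := by
    refine Submodule.smul_induction_on he (fun a ha x _ ↦ ?_) fun x y hx hy ↦ ?_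
    · rw [Algebra.smul_def, map_mul, ← IsScalarTower.algebraMap_apply,
        IsScalarTower.algebraMap_apply A B₁ C₁, RingHom.mem_ker.mp ha, map_zero, zero_mul]
    · rw [map_add, hx, hy, add_zero]
  have hsmul (c : C₂) : ∀ b ∈ RingHom.ker (algebraMap B₂ B₀),
      ∃ e ∈ I • (⊤ : Submodule A D), algebraMap D C₂ e = b • c := by
    have hcmem : c ∈ Submodule.span B₂ (Set.range (algebraMap D C₂)) := hspan ▸ Submodule.mem_top
    induction hcmem using Submodule.span_induction with
    | mem c hc' =>
      intro b hb'
      obtain ⟨x, rfl⟩ := hc'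
      obtain ⟨a, ha, rfl⟩ := hA.exists_mem_ker hb'
      refine ⟨a • x, Submodule.smul_mem_smul ha Submodule.mem_top, ?_⟩
      rw [algebraMap_smul, Algebra.smul_def, map_mul, ← IsScalarTower.algebraMap_apply,
        Algebra.smul_def]
    | zero => exact fun b _ ↦ ⟨0, Submodule.zero_mem _, by rw [map_zero, smul_zero]⟩
    | add x y _ _ hx hy =>
      intro b hb'
      obtain ⟨e, he, hex⟩ := hx b hb'
      obtain ⟨f, hf, hfy⟩ := hy b hb'
      exact ⟨e + f, Submodule.add_mem _ he hf, by rw [map_add, hex, hfy, smul_add]⟩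
    | smul s x _ hx =>
      intro b hb'
      obtain ⟨e, he, hex⟩ := hx (b * s) (Ideal.mul_mem_right _ _ hb')
      exact ⟨e, he, by rw [hex, mul_smul]⟩
  have hlift (c : C₂) (hc' : c ∈ RingHom.ker (algebraMap B₂ B₀) • (⊤ : Submodule B₂ C₂)) :
      ∃ e ∈ I • (⊤ : Submodule A D), algebraMap D C₂ e = c := by
    refine Submodule.smul_induction_on hc' (fun b hb' c _ ↦ hsmul c b hb') fun x y hx hy ↦ ?_
    obtain ⟨e, he, rfl⟩ := hx
    obtain ⟨f, hf, rfl⟩ := hy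
    exact ⟨e + f, Submodule.add_mem _ he hf, map_add _ _ _⟩
  have hd₀ : algebraMap C₂ C₀ (algebraMap D C₂ d) = 0 := by rw [← hD.comm, hd, map_zero]
  obtain ⟨e, he, hed⟩ := hlift _
    ((Algebra.IsPushout.out (R := B₂) (S := B₀) (R' := C₂) (S' := C₀)).mem_ker_smul_top hb hd₀)
  rwa [hD.ext d e (hd.trans (hI e he).symm) hed.symm]

/-- `C₂` is the base change of `D` along `A → B₂`. -/
lemma isBaseChange_right [Algebra A B₀] [Algebra A C₀] [Algebra B₁ C₀] [IsScalarTower A B₁ C₁] [IsScalarTower A D C₁] [IsScalarTower A B₂ C₂]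
    [IsScalarTower A D C₂] [IsScalarTower A B₁ B₀] [IsScalarTower A B₂ B₀] [IsScalarTower A B₀ C₀]
    [IsScalarTower A B₁ C₀] [IsScalarTower B₁ B₀ C₀] [IsScalarTower B₁ C₁ C₀]
    [IsScalarTower B₂ B₀ C₀] [IsScalarTower B₂ C₂ C₀]
    [Algebra.IsPushout B₁ B₀ C₁ C₀] [Algebra.IsPushout B₂ B₀ C₂ C₀] [Module.Flat B₂ C₂]
    (hD : IsFiberProduct D C₀ C₁ C₂)
    (hb : Surjective (algebraMap B₂ B₀)) (hbnil : IsNilpotent (RingHom.ker (algebraMap B₂ B₀)))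
    (hspan : Submodule.span B₂ (Set.range (algebraMap D C₂)) = ⊤)
    (hleft : IsBaseChange B₁ (IsScalarTower.toAlgHom A D C₁).toLinearMap) :
    IsBaseChange B₂ (IsScalarTower.toAlgHom A D C₂).toLinearMap := by
  let ψ := (IsScalarTower.toAlgHom A D C₂).toLinearMap.liftBaseChange B₂
  have hψ : Surjective ψ := by
    rw [← LinearMap.range_eq_top, eq_top_iff, ← hspan, Submodule.span_le]
    rintro _ ⟨d, rfl⟩
    exact ⟨1 ⊗ₜ d, by simp [ψ]⟩
  have h₀ := hleft.comp (Algebra.IsPushout.out (R := B₁) (S := B₀) (R' := C₁) (S' := C₀))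
  let e₁ := AlgebraTensorModule.cancelBaseChange A B₂ B₀ B₀ D
  let e₂ := (Algebra.IsPushout.out (R := B₂) (S := B₀) (R' := C₂) (S' := C₀)).equiv
  have hcomm (x : B₀ ⊗[B₂] (B₂ ⊗[A] D)) : e₂ (ψ.lTensor B₀ x) = h₀.equiv (e₁ x) := by
    induction x with
    | zero => simp
    | add x y hx hy => rw [map_add, map_add, hx, hy, map_add, map_add]
    | tmul b y =>
      induction y with
      | zero => simp
      | add x y hx hy => rw [tmul_add, map_add, map_add, hx, hy, map_add, map_add]
      | tmul b' d =>
        simp only [LinearMap.lTensor_tmul, e₁, e₂, ψ, AlgebraTensorModule.cancelBaseChange_tmul,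
          IsBaseChange.equiv_tmul, LinearMap.liftBaseChange_tmul, map_smul, LinearMap.comp_apply,
          LinearMap.restrictScalars_apply, AlgHom.toLinearMap_apply, IsScalarTower.toAlgHom_apply,
          hD.comm, smul_assoc]
        exact smul_comm _ _ _
  have hinj : Injective (ψ.lTensor B₀) := by
    refine Injective.of_comp (f := e₂) ?_
    convert h₀.equiv.injective.comp e₁.injective
    exact funext hcomm
  have hbij : Bijective ψ := ⟨LinearMap.injective_of_lTensor_injective hb hbnil hψ hinj, hψ⟩
  exact IsBaseChange.of_equiv (LinearEquiv.ofBijective ψ hbij) fun x ↦ by simp [ψ]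

/-- The map `D ⊗ I → D` is injective for `I` the kernel of `A → B₁`. -/
lemma lTensor_ker_subtype_injective [IsScalarTower A B₂ C₂] [IsScalarTower A D C₂]
    [Module.Flat B₂ C₂] (hA : IsFiberProduct A B₀ B₁ B₂)
    (hright : IsBaseChange B₂ (IsScalarTower.toAlgHom A D C₂).toLinearMap) :
    Injective ((RingHom.ker (algebraMap A B₁)).subtype.lTensor D) := by
  set I := RingHom.ker (algebraMap A B₁)
  set J := RingHom.ker (algebraMap B₂ B₀)
  let f : I →ₗ[A] J :=
    { toFun a := ⟨algebraMap A B₂ a, hA.mem_ker a.2⟩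
      map_add' a b := Subtype.ext (by simp)
      map_smul' a b := Subtype.ext (by simp [Algebra.smul_def]) }
  have hf : Bijective f := by
    refine ⟨fun a b hab ↦ Subtype.ext (hA.ext _ _ ?_ (congr_arg Subtype.val hab)), fun b ↦ ?_⟩
    · rw [RingHom.mem_ker.mp a.2, RingHom.mem_ker.mp b.2]
    · obtain ⟨a, ha, hab⟩ := hA.exists_mem_ker b.2
      exact ⟨⟨a, ha⟩, Subtype.ext hab⟩
  let e₁ : D ⊗[A] I ≃ₗ[A] J ⊗[A] D :=
    TensorProduct.comm A D I ≪≫ₗ (LinearEquiv.ofBijective f hf).rTensor D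
  let e₂ : J ⊗[A] D ≃ₗ[B₂] J ⊗[B₂] C₂ :=
    (AlgebraTensorModule.cancelBaseChange A B₂ B₂ J D).symm ≪≫ₗ hright.equiv.lTensor J
  let g : J ⊗[B₂] C₂ →ₗ[B₂] C₂ := (TensorProduct.lid B₂ C₂).toLinearMap ∘ₗ J.subtype.rTensor C₂
  have hg : Injective g := (TensorProduct.lid B₂ C₂).injective.comp
    (Module.Flat.rTensor_preserves_injective_linearMap _ J.subtype_injective)
  have hcomm (x : D ⊗[A] I) : algebraMap D C₂ (TensorProduct.rid A D (I.subtype.lTensor D x)) =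
      g (e₂ (e₁ x)) := by
    induction x with
    | zero => rw [map_zero, map_zero, map_zero, e₁.map_zero, e₂.map_zero, map_zero]
    | add x y hx hy => rw [map_add, map_add, map_add, hx, hy, e₁.map_add, e₂.map_add, map_add]
    | tmul d a =>
      have h₁ : e₁ (d ⊗ₜ a) = f a ⊗ₜ d := rfl
      have h₂ (j : J) : e₂ (j ⊗ₜ d) = j ⊗ₜ algebraMap D C₂ d := by
        change j ⊗ₜ (hright.equiv (1 ⊗ₜ d)) = _
        rw [hright.equiv_tmul, one_smul]
        rfl
      have h₃ (j : J) (c : C₂) : g (j ⊗ₜ c) = (j : B₂) • c := rfl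
      rw [h₁, h₂, h₃, LinearMap.lTensor_tmul, TensorProduct.rid_tmul, Algebra.smul_def, map_mul,
        ← IsScalarTower.algebraMap_apply]
      change algebraMap A C₂ a * _ = algebraMap A B₂ a • _
      rw [Algebra.smul_def, ← IsScalarTower.algebraMap_apply]
  refine Injective.of_comp (f := fun x ↦ algebraMap D C₂ (TensorProduct.rid A D x)) ?_
  convert hg.comp (e₂.injective.comp e₁.injective)
  exact funext hcomm

lemma flat [IsScalarTower A D C₁] [Module.Flat B₁ C₁] [IsScalarTower A B₁ C₁]
    (hA : IsFiberProduct A B₀ B₁ B₂)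
    (hb : Surjective (algebraMap B₂ B₀)) (hbnil : IsNilpotent (RingHom.ker (algebraMap B₂ B₀)))
    (hleft : IsBaseChange B₁ (IsScalarTower.toAlgHom A D C₁).toLinearMap)
    (hinj : Injective ((RingHom.ker (algebraMap A B₁)).subtype.lTensor D)) :
    Module.Flat A D := by
  have : Module.Flat B₁ (B₁ ⊗[A] D) := Module.Flat.of_linearEquiv hleft.equiv
  exact Module.flat_of_isNilpotent_ker (hA.surjective hb) (hA.isNilpotent_ker hbnil) hinj

lemma formallyUnramified [IsScalarTower A D C₁] [IsScalarTower A B₁ C₁]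
    [Algebra.FormallyUnramified B₁ C₁] (hA : IsFiberProduct A B₀ B₁ B₂)
    (hb : Surjective (algebraMap B₂ B₀)) (hbnil : IsNilpotent (RingHom.ker (algebraMap B₂ B₀)))
    (hleft : IsBaseChange B₁ (IsScalarTower.toAlgHom A D C₁).toLinearMap) :
    Algebra.FormallyUnramified A D := by
  have : Algebra.IsPushout A B₁ D C₁ := ⟨hleft⟩
  have : Subsingleton (B₁ ⊗[A] Ω[D⁄A]) :=
    (KaehlerDifferential.tensorKaehlerEquivBase A B₁ D C₁).injective.subsingleton
  exact ⟨subsingleton_of_subsingleton_tensorProduct (hA.surjective hb)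
    (hA.isNilpotent_ker hbnil)⟩

lemma finiteType [IsScalarTower A D C₁] [IsScalarTower A B₁ C₁]
    [Algebra.FiniteType B₁ C₁] (hA : IsFiberProduct A B₀ B₁ B₂)
    (hb : Surjective (algebraMap B₂ B₀)) (hbnil : IsNilpotent (RingHom.ker (algebraMap B₂ B₀)))
    (hD : Surjective (algebraMap D C₁))
    (hleft : IsBaseChange B₁ (IsScalarTower.toAlgHom A D C₁).toLinearMap) :
    Algebra.FiniteType A D := by
  classical
  have : Algebra.FiniteType A B₁ :=
    Algebra.FiniteType.of_surjective (Algebra.ofId A B₁) (hA.surjective hb)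
  have : Algebra.FiniteType A C₁ := .trans ‹Algebra.FiniteType A B₁› ‹_›
  obtain ⟨s, hs⟩ := Algebra.FiniteType.out (R := A) (A := C₁)
  obtain ⟨t, rfl⟩ : ∃ t : Finset D, t.image (algebraMap D C₁) = s :=
    ⟨s.image (surjInv hD), by simp [Finset.image_image, comp_surjInv]⟩
  refine ⟨t, ?_⟩
  rw [← Algebra.toSubmodule_eq_top]
  refine Submodule.eq_top_of_sup_smul_top_eq_top (hA.isNilpotent_ker hbnil)
    (eq_top_iff.mpr fun d _ ↦ ?_)
  have hd : algebraMap D C₁ d ∈ (Algebra.adjoin A (t : Set D)).map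
      (IsScalarTower.toAlgHom A D C₁) := by
    rw [AlgHom.map_adjoin]
    simp_all
  obtain ⟨p, hp, hpd⟩ := hd
  rw [← add_sub_cancel p d]
  refine Submodule.add_mem_sup hp (hleft.mem_ker_smul_top (hA.surjective hb) ?_)
  simpa [sub_eq_zero] using hpd.symm

end IsFiberProduct

end FiberProduct

end AuxiliaryLemmas

/-- **Pushing out étale maps** (Lemma `pushing-out-etale-maps`).
Given a commutative diagram of Noetherian rings with rows `B₁ → B₀ ← B₂` and
`C₁ → C₀ ← C₂` (encoded via algebra structures and scalar towers), where
`B₂ → B₀` and `C₂ → C₀` are surjective with nilpotent kernel, both squares are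
co-cartesian (pushouts), and all vertical maps `Bᵢ → Cᵢ` are flat and
unramified (finite type with vanishing differentials, i.e. formally
unramified), the induced map `B₁ ×_{B₀} B₂ → C₁ ×_{C₀} C₂` of fiber products
is also flat and unramified. -/
theorem fiberProduct_flat_unramified
    (B₀ B₁ B₂ C₀ C₁ C₂ : Type*)
    [CommRing B₀] [CommRing B₁] [CommRing B₂]
    [CommRing C₀] [CommRing C₁] [CommRing C₂]
    [IsNoetherianRing B₀] [IsNoetherianRing B₁] [IsNoetherianRing B₂]
    [IsNoetherianRing C₀] [IsNoetherianRing C₁] [IsNoetherianRing C₂]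
    [Algebra B₁ B₀] [Algebra B₂ B₀] [Algebra C₁ C₀] [Algebra C₂ C₀]
    [Algebra B₁ C₁] [Algebra B₂ C₂] [Algebra B₀ C₀]
    [Algebra B₁ C₀] [Algebra B₂ C₀]
    [IsScalarTower B₁ B₀ C₀] [IsScalarTower B₁ C₁ C₀]
    [IsScalarTower B₂ B₀ C₀] [IsScalarTower B₂ C₂ C₀]
    -- `b : B₂ → B₀` and `c : C₂ → C₀` surjective with nilpotent kernel
    (hb : Function.Surjective (algebraMap B₂ B₀))
    (hbnil : IsNilpotent (RingHom.ker (algebraMap B₂ B₀)))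
    (hc : Function.Surjective (algebraMap C₂ C₀))
    (hcnil : IsNilpotent (RingHom.ker (algebraMap C₂ C₀)))
    -- both squares co-cartesian
    [Algebra.IsPushout B₁ B₀ C₁ C₀] [Algebra.IsPushout B₂ B₀ C₂ C₀]
    -- vertical maps flat and unramified
    [Module.Flat B₁ C₁] [Module.Flat B₂ C₂]
    [Algebra.FormallyUnramified B₁ C₁] [Algebra.FormallyUnramified B₂ C₂]
    [Algebra.FiniteType B₁ C₁] [Algebra.FiniteType B₂ C₂]
    -- the fiber products `B₁ ×_{B₀} B₂` and `C₁ ×_{C₀} C₂` as subrings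
    (PB : Subring (B₁ × B₂))
    (hPB : (PB : Set (B₁ × B₂)) = {p | algebraMap B₁ B₀ p.1 = algebraMap B₂ B₀ p.2})
    (PC : Subring (C₁ × C₂))
    (hPC : (PC : Set (C₁ × C₂)) = {p | algebraMap C₁ C₀ p.1 = algebraMap C₂ C₀ p.2})
    -- the natural induced map on fiber products
    (F : PB →+* PC)
    (hF : ∀ p : PB, ((F p : C₁ × C₂)) =
      (algebraMap B₁ C₁ (p : B₁ × B₂).1, algebraMap B₂ C₂ (p : B₁ × B₂).2)) :
    F.Flat ∧
      (letI : Algebra PB PC := F.toAlgebra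
       Algebra.FormallyUnramified PB PC) ∧
      F.FiniteType := by
  have hB (p : PB) : algebraMap B₁ B₀ (p : B₁ × B₂).1 = algebraMap B₂ B₀ (p : B₁ × B₂).2 := by
    have := p.2
    rwa [← SetLike.mem_coe, hPB] at this
  have hC (p : PC) : algebraMap C₁ C₀ (p : C₁ × C₂).1 = algebraMap C₂ C₀ (p : C₁ × C₂).2 := by
    have := p.2
    rwa [← SetLike.mem_coe, hPC] at this
  let : Algebra PB PC := F.toAlgebra
  let : Algebra PB B₁ := ((RingHom.fst B₁ B₂).comp PB.subtype).toAlgebra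
  let : Algebra PB B₂ := ((RingHom.snd B₁ B₂).comp PB.subtype).toAlgebra
  let : Algebra PC C₁ := ((RingHom.fst C₁ C₂).comp PC.subtype).toAlgebra
  let : Algebra PC C₂ := ((RingHom.snd C₁ C₂).comp PC.subtype).toAlgebra
  let : Algebra PB B₀ := ((algebraMap B₁ B₀).comp (algebraMap PB B₁)).toAlgebra
  let : Algebra PB C₀ := ((algebraMap B₁ C₀).comp (algebraMap PB B₁)).toAlgebra
  let : Algebra PB C₁ := ((algebraMap B₁ C₁).comp (algebraMap PB B₁)).toAlgebra
  let : Algebra PB C₂ := ((algebraMap B₂ C₂).comp (algebraMap PB B₂)).toAlgebra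
  have : IsScalarTower PB B₁ B₀ := .of_algebraMap_eq fun _ ↦ rfl
  have : IsScalarTower PB B₁ C₀ := .of_algebraMap_eq fun _ ↦ rfl
  have : IsScalarTower PB B₁ C₁ := .of_algebraMap_eq fun _ ↦ rfl
  have : IsScalarTower PB B₂ C₂ := .of_algebraMap_eq fun _ ↦ rfl
  have : IsScalarTower PB B₂ B₀ := .of_algebraMap_eq hB
  have : IsScalarTower PB B₀ C₀ :=
    .of_algebraMap_eq fun p ↦ IsScalarTower.algebraMap_apply B₁ B₀ C₀ _
  have : IsScalarTower PB PC C₁ := .of_algebraMap_eq fun p ↦ (congr_arg Prod.fst (hF p)).symm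
  have : IsScalarTower PB PC C₂ := .of_algebraMap_eq fun p ↦ (congr_arg Prod.snd (hF p)).symm
  have hA : IsFiberProduct PB B₀ B₁ B₂ :=
    ⟨hB, fun _ _ h₁ h₂ ↦ Subtype.ext (Prod.ext h₁ h₂), fun b₁ b₂ h ↦
      ⟨⟨(b₁, b₂), by rwa [← SetLike.mem_coe, hPB]⟩, rfl, rfl⟩⟩
  have hD : IsFiberProduct PC C₀ C₁ C₂ :=
    ⟨hC, fun _ _ h₁ h₂ ↦ Subtype.ext (Prod.ext h₁ h₂), fun c₁ c₂ h ↦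
      ⟨⟨(c₁, c₂), by rwa [← SetLike.mem_coe, hPC]⟩, rfl, rfl⟩⟩
  have hspan := IsFiberProduct.span_range_eq_top (B₁ := B₁) hD hb hbnil hc
  have hleft := hA.isBaseChange_left hD hb hc hspan
  have hright := IsFiberProduct.isBaseChange_right (B₁ := B₁) hD hb hbnil hspan hleft
  exact ⟨hA.flat hb hbnil hleft (hA.lTensor_ker_subtype_injective hright),
    hA.formallyUnramified hb hbnil hleft, hA.finiteType hb hbnil (hD.surjective hc) hleft⟩
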